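/- Let k ≥ 1. If 2/3 ≤ a < 1 or a = 1/3, then M_{k,a} does not have a finite derivative at any point x ∈ (0,1); that is, at no x ∈ (0,1) does the limit of (M_{k,a}(y) − M_{k,a}(x))/(y−x) as y → x exist as a finite real number. -/

import Mathlib

open Filter Topology MeasureTheory Set
open scoped ENNReal

/-- The `(n+1)`-th ternary digit of `x` (choosing the expansion ending in all `0`s
when two expansions exist, and the all-`2`s expansion for `x = 1`). -/
noncomputable def tDigit (x : ℝ) (n : ℕ) : ℕ :=
  if x = 1 then 2 else (⌊(3:ℝ) ^ (n + 1) * x⌋ - 3 * ⌊(3:ℝ) ^ n * x⌋).toNat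

/-- `l_n(x)`: the number of `1`s among the first `n` ternary digits of `x`. -/
noncomputable def lCount (x : ℝ) (n : ℕ) : ℕ :=
  ((Finset.range n).filter (fun i => tDigit x i = 1)).card

/-- `q_a(d)` with `q_a(0)=0`, `q_a(1)=a`, `q_a(2)=1-a`. -/
noncomputable def qDig (a : ℝ) (d : ℕ) : ℝ :=
  if d = 0 then 0 else if d = 1 then a else 1 - a

/-- Okamoto's function `F_a`. -/
noncomputable def Okamoto (a x : ℝ) : ℝ :=
  ∑' n : ℕ, a ^ (n - lCount x n) * (1 - 2 * a) ^ lCount x n * qDig a (tDigit x n)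

/-- `M_{k,a}(x)`: the `k`-th partial derivative of `F_a(x)` with respect to `a`. -/
noncomputable def Mfun (k : ℕ) (a x : ℝ) : ℝ :=
  iteratedDeriv k (fun b => Okamoto b x) a

/-- `f` has derivative `+∞` at `x` (difference quotients over `y ∈ [0,1] \ {x}`). -/
def derivPInf (f : ℝ → ℝ) (x : ℝ) : Prop :=
  Tendsto (fun y => (f y - f x) / (y - x)) (𝓝[Set.Icc 0 1 \ {x}] x) atTop

/-- `f` has derivative `-∞` at `x`. -/
def derivMInf (f : ℝ → ℝ) (x : ℝ) : Prop :=
  Tendsto (fun y => (f y - f x) / (y - x)) (𝓝[Set.Icc 0 1 \ {x}] x) atBot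

noncomputable def phiOk (a : ℝ) : ℝ :=
  if a = 1/3 then 1/3 else if a = 1/2 then 0
  else Real.log (3 * a) / (Real.log a - Real.log |1 - 2 * a|)

noncomputable def C0 (a : ℝ) : ℝ := 1 / (Real.log a - Real.log |1 - 2 * a|)

noncomputable def hEnt (p : ℝ) : ℝ :=
  (-(p * Real.log p) - (1 - p) * Real.log (1 - p) + (1 - p) * Real.log 2) / Real.log 3

noncomputable def dOk (a : ℝ) : ℝ := hEnt (phiOk a)

noncomputable def dTilde (a : ℝ) : ℝ := hEnt (1 - 2 * a)

open Polynomial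

/-- The factor, as a polynomial in the parameter, by which increments of Okamoto's function
shrink on passing to the subinterval with ternary digit `d`. -/
noncomputable def okRatio (d : ℕ) : ℝ[X] := if d = 1 then 1 - 2 * X else X

/-- The increment of Okamoto's function over `[j / 3 ^ n, (j + 1) / 3 ^ n]`, as a polynomial in the
parameter. -/
noncomputable def okIncr (n j : ℕ) : ℝ[X] := ∏ i ∈ Finset.range n, okRatio (j / 3 ^ i % 3)

lemma okIncr_zero (j : ℕ) : okIncr 0 j = 1 := by simp [okIncr]

lemma okIncr_succ (n j : ℕ) : okIncr (n + 1) j = okIncr n (j / 3) * okRatio (j % 3) := by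
  simp only [okIncr, Finset.prod_range_succ', pow_zero, Nat.div_one, Nat.div_div_eq_div_mul,
    pow_succ']

lemma okIncr_leading (n d j : ℕ) (hd : d < 3) (hj : j < 3 ^ n) :
    okIncr (n + 1) (3 ^ n * d + j) = okRatio d * okIncr n j := by
  induction n generalizing j with
  | zero =>
    obtain rfl : j = 0 := by simpa using hj
    simp [okIncr_succ, okIncr_zero, Nat.mod_eq_of_lt hd]
  | succ n ih =>
    have h : 3 ^ (n + 1) * d = 3 * (3 ^ n * d) := by ring
    have hj' : j / 3 < 3 ^ n := by rw [pow_succ] at hj; omega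
    rw [okIncr_succ, h, show (3 * (3 ^ n * d) + j) / 3 = 3 ^ n * d + j / 3 by omega,
      show (3 * (3 ^ n * d) + j) % 3 = j % 3 by omega, ih _ hj', okIncr_succ n j, mul_assoc]

lemma sum_okIncr_leading (n d j : ℕ) (hd : d < 3) (hj : j ≤ 3 ^ n) :
    ∑ i ∈ Finset.range j, okIncr (n + 1) (3 ^ n * d + i) =
      okRatio d * ∑ i ∈ Finset.range j, okIncr n i := by
  rw [Finset.mul_sum]
  refine Finset.sum_congr rfl fun i hi => okIncr_leading n d i hd ?_
  exact (Finset.mem_range.1 hi).trans_le hj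

lemma sum_okIncr_split (n d j : ℕ) (hd : d < 3) (hj : j ≤ 3 ^ n) :
    ∑ i ∈ Finset.range (3 ^ n * d + j), okIncr (n + 1) i =
      (∑ e ∈ Finset.range d, okRatio e) * ∑ i ∈ Finset.range (3 ^ n), okIncr n i +
        okRatio d * ∑ i ∈ Finset.range j, okIncr n i := by
  rw [Finset.sum_range_add, sum_okIncr_leading n d j hd hj]
  congr 1
  induction d with
  | zero => simp
  | succ d ih =>
    rw [Nat.mul_succ, Finset.sum_range_add, ih (by omega),
      sum_okIncr_leading n d _ (by omega) le_rfl, Finset.sum_range_succ, add_mul]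

lemma sum_okIncr (n : ℕ) : ∑ i ∈ Finset.range (3 ^ n), okIncr n i = 1 := by
  induction n with
  | zero => simp [okIncr_zero]
  | succ n ih =>
    rw [show 3 ^ (n + 1) = 3 ^ n * 2 + 3 ^ n by ring, sum_okIncr_split n 2 _ (by norm_num) le_rfl,
      ih]
    simp [Finset.sum_range_succ, okRatio]
    ring

lemma tDigit_zero_of_branch {d : ℕ} (hd : d < 3) {y : ℝ} (hy : y ∈ Icc (0 : ℝ) 1)
    (h : d = 2 ∨ y < 1) : tDigit ((d + y) / 3) 0 = d := by
  obtain rfl | hy1 := eq_or_lt_of_le hy.2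
  · obtain rfl : d = 2 := by simpa using h
    norm_num [tDigit]
  · have hd' : (d : ℝ) ≤ 2 := by exact_mod_cast Nat.lt_succ_iff.1 hd
    have h1 : ⌊((d : ℝ) + y) / 3⌋ = 0 := by
      rw [Int.floor_eq_zero_iff]
      constructor
      · have := hy.1
        positivity
      · linarith
    have h2 : ⌊(3 : ℝ) * (((d : ℝ) + y) / 3)⌋ = d := by
      rw [Int.floor_eq_iff]
      push_cast
      constructor <;> linarith [hy.1]
    have h3 : ((d : ℝ) + y) / 3 ≠ 1 := by linarith
    simp [tDigit, h1, h2, h3]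

lemma tDigit_succ_of_branch {d : ℕ} (hd : d < 3) {y : ℝ} (hy : y ∈ Icc (0 : ℝ) 1)
    (h : d = 2 ∨ y < 1) (n : ℕ) : tDigit ((d + y) / 3) (n + 1) = tDigit y n := by
  obtain rfl | hy1 := eq_or_lt_of_le hy.2
  · obtain rfl : d = 2 := by simpa using h
    norm_num [tDigit]
  · have hd' : (d : ℝ) ≤ 2 := by exact_mod_cast Nat.lt_succ_iff.1 hd
    have h3 : ((d : ℝ) + y) / 3 ≠ 1 := by linarith
    have key (m : ℕ) : ⌊(3 : ℝ) ^ (m + 1) * (((d : ℝ) + y) / 3)⌋ = ⌊(3 : ℝ) ^ m * y⌋ + 3 ^ m * d := by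
      rw [← Int.floor_add_intCast]
      congr 1
      push_cast
      ring
    simp only [tDigit, h3, hy1.ne, if_false, key]
    congr 1
    ring

lemma lCount_succ_of_branch {d : ℕ} (hd : d < 3) {y : ℝ} (hy : y ∈ Icc (0 : ℝ) 1)
    (h : d = 2 ∨ y < 1) (n : ℕ) :
    lCount ((d + y) / 3) (n + 1) = lCount y n + if d = 1 then 1 else 0 := by
  simp only [lCount, Finset.card_filter, Finset.sum_range_succ', tDigit_zero_of_branch hd hy h,
    tDigit_succ_of_branch hd hy h]

lemma lCount_le (x : ℝ) (n : ℕ) : lCount x n ≤ n := by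
  simpa [lCount] using Finset.card_filter_le (Finset.range n) (fun i => tDigit x i = 1)

lemma summable_okamoto {b : ℝ} (hb : b ∈ Ioo (0 : ℝ) 1) (x : ℝ) :
    Summable fun n : ℕ =>
      b ^ (n - lCount x n) * (1 - 2 * b) ^ lCount x n * qDig b (tDigit x n) := by
  obtain ⟨hb0, hb1⟩ := hb
  have hlt : |1 - 2 * b| < 1 := abs_lt.2 ⟨by linarith, by linarith⟩
  refine Summable.of_norm_bounded
    (summable_geometric_of_lt_one (r := max b |1 - 2 * b|) (le_max_of_le_left hb0.le)
      (max_lt hb1 hlt)) fun n => ?_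
  have hq : |qDig b (tDigit x n)| ≤ 1 := by
    unfold qDig
    split_ifs <;> rw [abs_le] <;> constructor <;> linarith
  rw [Real.norm_eq_abs, abs_mul, abs_mul, abs_pow, abs_pow, abs_of_pos hb0]
  calc b ^ (n - lCount x n) * |1 - 2 * b| ^ lCount x n * |qDig b (tDigit x n)|
      ≤ max b |1 - 2 * b| ^ (n - lCount x n) * max b |1 - 2 * b| ^ lCount x n * 1 := by
        gcongr
        · exact le_max_left _ _
        · exact le_max_right _ _
    _ = max b |1 - 2 * b| ^ n := by
        rw [mul_one, ← pow_add, Nat.sub_add_cancel (lCount_le x n)]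

lemma okamoto_branch {b : ℝ} (hb : b ∈ Ioo (0 : ℝ) 1) {d : ℕ} (hd : d < 3) {y : ℝ}
    (hy : y ∈ Icc (0 : ℝ) 1) (h : d = 2 ∨ y < 1) :
    Okamoto b ((d + y) / 3) = qDig b d + (okRatio d).eval b * Okamoto b y := by
  unfold Okamoto
  rw [(summable_okamoto hb _).tsum_eq_zero_add, ← tsum_mul_left, tDigit_zero_of_branch hd hy h]
  congr 1
  · simp [lCount]
  · refine tsum_congr fun n => ?_
    rw [tDigit_succ_of_branch hd hy h, lCount_succ_of_branch hd hy h]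
    have hl := lCount_le y n
    by_cases h1 : d = 1
    · simp [h1, okRatio]
      ring
    · simp [h1, okRatio, Nat.sub_add_comm hl]
      ring

lemma okamoto_zero {b : ℝ} (hb : b ∈ Ioo (0 : ℝ) 1) : Okamoto b 0 = 0 := by
  have h := okamoto_branch hb (d := 0) (y := 0) (by norm_num) (by simp) (by simp)
  have h1 : Okamoto b 0 = b * Okamoto b 0 := by simpa [qDig, okRatio] using h
  have h2 : (1 - b) * Okamoto b 0 = 0 := by linarith
  exact (mul_eq_zero.1 h2).resolve_left (by linarith [hb.2])

lemma okamoto_one {b : ℝ} (hb : b ∈ Ioo (0 : ℝ) 1) : Okamoto b 1 = 1 := by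
  have h := okamoto_branch hb (d := 2) (y := 1) (by norm_num) (by simp) (by simp)
  have h1 : Okamoto b 1 = 1 - b + b * Okamoto b 1 := by
    norm_num [qDig, okRatio] at h
    exact h
  have h2 : (1 - b) * (Okamoto b 1 - 1) = 0 := by linarith
  exact sub_eq_zero.1 ((mul_eq_zero.1 h2).resolve_left (by linarith [hb.2]))

lemma sum_okRatio_eval (b : ℝ) {d : ℕ} (hd : d < 3) :
    (∑ e ∈ Finset.range d, okRatio e).eval b = qDig b d := by
  interval_cases d <;> simp [Finset.sum_range_succ, okRatio, qDig]
  ring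

/-- At triadic rationals Okamoto's function is a polynomial in its parameter. -/
lemma okamoto_triadic {b : ℝ} (hb : b ∈ Ioo (0 : ℝ) 1) (n j : ℕ) (hj : j ≤ 3 ^ n) :
    Okamoto b (j / 3 ^ n) = (∑ i ∈ Finset.range j, okIncr n i).eval b := by
  induction n generalizing j with
  | zero =>
    obtain rfl | rfl : j = 0 ∨ j = 1 := by
      rw [pow_zero] at hj
      omega
    · simp [okamoto_zero hb]
    · simp [okamoto_one hb, okIncr_zero]
  | succ n ih =>
    obtain rfl | hlt := eq_or_lt_of_le hj
    · rw [sum_okIncr]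
      simp [okamoto_one hb]
    have h3 : 0 < 3 ^ n := by positivity
    have hd : j / 3 ^ n < 3 := Nat.div_lt_of_lt_mul (by rwa [pow_succ] at hlt)
    have hr : j % 3 ^ n < 3 ^ n := Nat.mod_lt _ h3
    have hy1 : ((j % 3 ^ n : ℕ) : ℝ) / 3 ^ n < 1 := by
      rw [div_lt_one (by positivity)]
      exact_mod_cast hr
    have hx : (j : ℝ) / 3 ^ (n + 1) = ((j / 3 ^ n : ℕ) + ((j % 3 ^ n : ℕ) : ℝ) / 3 ^ n) / 3 := by
      have h : (j : ℝ) = 3 ^ n * (j / 3 ^ n : ℕ) + (j % 3 ^ n : ℕ) := by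
        exact_mod_cast (Nat.div_add_mod j (3 ^ n)).symm
      rw [h, pow_succ]
      field_simp
    rw [hx, okamoto_branch hb hd ⟨by positivity, hy1.le⟩ (Or.inr hy1), ih _ hr.le]
    conv_rhs => rw [← Nat.div_add_mod j (3 ^ n)]
    rw [sum_okIncr_split n _ _ hd hr.le, sum_okIncr, mul_one, eval_add, eval_mul,
      sum_okRatio_eval b hd]

lemma iteratedDeriv_polynomial_eval (k : ℕ) (p : ℝ[X]) (a : ℝ) :
    iteratedDeriv k (fun b => p.eval b) a = k.factorial * (taylor a p).coeff k := by
  have h : iteratedDeriv k (fun b => p.eval b) = fun b => (derivative^[k] p).eval b := by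
    induction k with
    | zero => simp
    | succ k ih =>
      rw [iteratedDeriv_succ, ih, Function.iterate_succ_apply']
      ext b
      simp
  rw [h, taylor_coeff, ← factorial_smul_hasseDeriv]
  simp

lemma Mfun_sub_triadic {a : ℝ} (ha : a ∈ Ioo (0 : ℝ) 1) (k n j : ℕ) (hj : j < 3 ^ n) :
    Mfun k a ((j + 1 : ℕ) / 3 ^ n) - Mfun k a (j / 3 ^ n) =
      k.factorial * (taylor a (okIncr n j)).coeff k := by
  have key (i : ℕ) (hi : i ≤ 3 ^ n) : Mfun k a (i / 3 ^ n) =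
      k.factorial * (taylor a (∑ i ∈ Finset.range i, okIncr n i)).coeff k := by
    rw [← iteratedDeriv_polynomial_eval]
    refine Filter.EventuallyEq.iteratedDeriv_eq k ?_
    filter_upwards [isOpen_Ioo.mem_nhds ha] with b hb using okamoto_triadic hb n i hi
  rw [key _ hj, key _ hj.le, Finset.sum_range_succ, map_add, coeff_add]
  ring

lemma exists_descendant (n j m i : ℕ) (hi : i ≤ m) :
    ∃ c, 3 ^ m * j ≤ c ∧ c < 3 ^ m * (j + 1) ∧
      okIncr (n + m) c = okIncr n j * (X ^ (m - i) * (1 - 2 * X) ^ i) := by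
  induction m generalizing i with
  | zero =>
    obtain rfl : i = 0 := by omega
    exact ⟨j, by simp⟩
  | succ m ih =>
    have hp (t : ℕ) : 3 ^ (m + 1) * t = 3 * (3 ^ m * t) := by ring
    rw [hp, hp]
    obtain rfl | hlt := eq_or_lt_of_le hi
    · obtain ⟨c, h1, h2, h3⟩ := ih m le_rfl
      refine ⟨3 * c + 1, by omega, by omega, ?_⟩
      rw [← add_assoc, okIncr_succ, show (3 * c + 1) / 3 = c by omega,
        show (3 * c + 1) % 3 = 1 by omega, h3]
      simp [okRatio]
      ring
    · obtain ⟨c, h1, h2, h3⟩ := ih i (by omega)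
      refine ⟨3 * c, by omega, by omega, ?_⟩
      rw [← add_assoc, okIncr_succ, show 3 * c / 3 = c by omega,
        show 3 * c % 3 = 0 by omega, h3, Nat.sub_add_comm (by omega : i ≤ m)]
      simp [okRatio]
      ring

/-- Binomial expansion of `(b - a) ^ k` in the basis `b ^ (k - i) * (1 - 2 * b) ^ i`. -/
lemma sub_pow_eq_sum_descendants (a : ℝ) (k : ℕ) :
    ((X - C a) ^ k : ℝ[X]) = ∑ i ∈ Finset.range (k + 1),
      C ((-a) ^ i * (1 - 2 * a) ^ (k - i) * k.choose i) * (X ^ (k - i) * (1 - 2 * X) ^ i) := by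
  have h : (X - C a : ℝ[X]) = C (-a) * (1 - 2 * X) + C (1 - 2 * a) * X := by
    simp only [C_neg, C_sub, C_1, C_mul, C_ofNat]
    ring
  rw [h, add_pow]
  refine Finset.sum_congr rfl fun i _ => ?_
  simp only [mul_pow, C_mul, C_pow, C_eq_natCast]
  ring

lemma eval_eq_sum_taylor_coeff (p : ℝ[X]) (a : ℝ) (k : ℕ) :
    p.eval a = ∑ i ∈ Finset.range (k + 1), (-a) ^ i * (1 - 2 * a) ^ (k - i) * k.choose i *
      (taylor a (p * (X ^ (k - i) * (1 - 2 * X) ^ i))).coeff k := by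
  have h : (taylor a ((X - C a) ^ k * p)).coeff k = p.eval a := by
    rw [taylor_mul, taylor_pow, map_sub, taylor_X, taylor_C, add_sub_cancel_right,
      coeff_X_pow_mul', if_pos le_rfl, Nat.sub_self, taylor_coeff_zero]
  rw [← h, sub_pow_eq_sum_descendants, Finset.sum_mul, map_sum, finsetSum_coeff]
  refine Finset.sum_congr rfl fun i _ => ?_
  rw [mul_assoc (C _), C_mul', map_smul, coeff_smul, smul_eq_mul, mul_comm p]

lemma HasDerivAt.tendsto_slope_of_geometric {f : ℝ → ℝ} {d x : ℝ} (hf : HasDerivAt f d x)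
    {u v : ℕ → ℝ} {c : ℝ} (hu : ∀ n, |u n - x| ≤ (1 / 3) ^ n) (hv : ∀ n, |v n - x| ≤ (1 / 3) ^ n)
    (huv : ∀ n, v n - u n = (1 / 3) ^ n * c) :
    Tendsto (fun n => 3 ^ n * (f (v n) - f (u n))) atTop (𝓝 (d * c)) := by
  have aux (w : ℕ → ℝ) (hw : ∀ n, |w n - x| ≤ (1 / 3) ^ n) :
      (fun n => f (w n) - f x - (w n - x) * d) =o[atTop] fun n => ((1 : ℝ) / 3) ^ n := by
    have ht : Tendsto w atTop (𝓝 x) := by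
      rw [tendsto_iff_norm_sub_tendsto_zero]
      exact squeeze_zero (fun n => norm_nonneg _) hw
        (tendsto_pow_atTop_nhds_zero_of_lt_one (by norm_num) (by norm_num))
    refine (hf.isLittleO.comp_tendsto ht).trans_isBigO (Asymptotics.IsBigO.of_bound 1 ?_)
    refine Eventually.of_forall fun n => ?_
    have h := hw n
    simp only [Function.comp_apply, Real.norm_eq_abs, one_mul]
    rwa [abs_of_nonneg (by positivity : (0 : ℝ) ≤ (1 / 3) ^ n)]
  have h := ((aux v hv).sub (aux u hu)).tendsto_div_nhds_zero
  have h2 := h.add_const (d * c)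
  rw [zero_add] at h2
  refine h2.congr fun n => ?_
  have e : f (v n) - f x - (v n - x) * d - (f (u n) - f x - (u n - x) * d) =
      f (v n) - f (u n) - (1 / 3) ^ n * c * d := by
    rw [← huv n]
    ring
  rw [e, one_div, inv_pow]
  field_simp
  ring

/-- If `M_{k,a}` is differentiable at `x`, the rescaled increments of `F_a` around `x` converge. -/
lemma tendsto_okIncr_of_hasDerivAt {k : ℕ} {a x d : ℝ} (ha : a ∈ Ioo (0 : ℝ) 1)
    (hx : x ∈ Ioo (0 : ℝ) 1) (hd : HasDerivAt (Mfun k a) d x) :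
    Tendsto (fun n => 3 ^ n * (okIncr n ⌊3 ^ n * x⌋₊).eval a) atTop
      (𝓝 (d * (1 / 3) ^ k / k.factorial * (1 - 3 * a) ^ k)) := by
  have hfloor (n : ℕ) : (⌊3 ^ n * x⌋₊ : ℝ) ≤ 3 ^ n * x := Nat.floor_le (by have := hx.1; positivity)
  have hfloor' (n : ℕ) : 3 ^ n * x < ⌊3 ^ n * x⌋₊ + 1 := Nat.lt_floor_add_one _
  have hlt (n : ℕ) : ⌊3 ^ n * x⌋₊ + 1 ≤ 3 ^ n := by
    rw [Nat.succ_le_iff, Nat.floor_lt (by have := hx.1; positivity)]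
    push_cast
    exact mul_lt_of_lt_one_right (by positivity) hx.2
  have key (i : ℕ) (hi : i ∈ Finset.range (k + 1)) :
      Tendsto (fun n => 3 ^ n * (taylor a (okIncr n ⌊3 ^ n * x⌋₊ *
        (X ^ (k - i) * (1 - 2 * X) ^ i))).coeff k) atTop (𝓝 (d * (1 / 3) ^ k / k.factorial)) := by
    choose c hc1 hc2 hc3 using fun n =>
      exists_descendant n ⌊3 ^ n * x⌋₊ k i (Nat.lt_succ_iff.1 (Finset.mem_range.1 hi))
    have hclose (n t : ℕ) (h1 : 3 ^ k * ⌊3 ^ n * x⌋₊ ≤ t) (h2 : t ≤ 3 ^ k * (⌊3 ^ n * x⌋₊ + 1)) :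
        |(t : ℝ) / 3 ^ (n + k) - x| ≤ (1 / 3) ^ n := by
      have h1' : (3 : ℝ) ^ k * ⌊3 ^ n * x⌋₊ ≤ t := by exact_mod_cast h1
      have h2' : (t : ℝ) ≤ 3 ^ k * (⌊3 ^ n * x⌋₊ + 1) := by exact_mod_cast h2
      have h3 : (3 : ℝ) ^ k * ⌊3 ^ n * x⌋₊ ≤ 3 ^ k * (3 ^ n * x) := by gcongr; exact hfloor n
      have h4 : (3 : ℝ) ^ k * (3 ^ n * x) ≤ 3 ^ k * (⌊3 ^ n * x⌋₊ + 1) := by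
        gcongr
        exact (hfloor' n).le
      have e : (t : ℝ) / 3 ^ (n + k) - x = (t - 3 ^ k * (3 ^ n * x)) / 3 ^ (n + k) := by
        rw [pow_add]
        field_simp
      have e' : ((1 : ℝ) / 3) ^ n = 3 ^ k / 3 ^ (n + k) := by
        rw [pow_add, one_div, inv_pow]
        field_simp
      rw [e, e', abs_div, abs_of_pos (by positivity : (0 : ℝ) < 3 ^ (n + k))]
      gcongr
      rw [abs_le]
      constructor <;> linarith
    have ht := hd.tendsto_slope_of_geometric (u := fun n => (c n : ℝ) / 3 ^ (n + k))
      (v := fun n => ((c n + 1 : ℕ) : ℝ) / 3 ^ (n + k)) (c := (1 / 3) ^ k)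
      (fun n => hclose n _ (hc1 n) (hc2 n).le)
      (fun n => hclose n _ ((hc1 n).trans (Nat.le_succ _)) (hc2 n))
      (fun n => by
        rw [← pow_add, one_div, inv_pow]
        push_cast
        field_simp
        ring)
    refine (ht.div_const (k.factorial : ℝ)).congr fun n => ?_
    have hcn : c n < 3 ^ (n + k) := by
      refine (hc2 n).trans_le ?_
      rw [add_comm n, pow_add]
      exact Nat.mul_le_mul_left _ (hlt n)
    rw [Mfun_sub_triadic ha k (n + k) (c n) hcn, hc3]
    have := k.factorial_ne_zero
    field_simp
  have hsum := tendsto_finsetSum (Finset.range (k + 1)) fun i hi =>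
    (key i hi).const_mul ((-a) ^ i * (1 - 2 * a) ^ (k - i) * k.choose i)
  have hlim : ∑ i ∈ Finset.range (k + 1), (-a) ^ i * (1 - 2 * a) ^ (k - i) * k.choose i *
      (d * (1 / 3) ^ k / k.factorial) = d * (1 / 3) ^ k / k.factorial * (1 - 3 * a) ^ k := by
    rw [← Finset.sum_mul, ← add_pow, mul_comm]
    ring
  rw [hlim] at hsum
  refine hsum.congr fun n => ?_
  rw [eval_eq_sum_taylor_coeff _ a k, Finset.mul_sum]
  exact Finset.sum_congr rfl fun i _ => by ring

lemma okIncr_floor_succ (x : ℝ) (n : ℕ) :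
    okIncr (n + 1) ⌊3 ^ (n + 1) * x⌋₊ =
      okIncr n ⌊3 ^ n * x⌋₊ * okRatio (⌊3 ^ (n + 1) * x⌋₊ % 3) := by
  have h : ⌊3 ^ (n + 1) * x⌋₊ / 3 = ⌊3 ^ n * x⌋₊ := by
    rw [← Nat.floor_div_ofNat]
    congr 1
    ring
  rw [okIncr_succ, h]

/-- for `k ≥ 1`, if `2/3 ≤ a < 1` or `a = 1/3`, then `M_{k,a}` has no finite
derivative at any point of `(0,1)`. -/
theorem stmt5 (k : ℕ) (hk : 1 ≤ k) (a : ℝ) (ha : (2/3 ≤ a ∧ a < 1) ∨ a = 1/3)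
    (x : ℝ) (hx : x ∈ Set.Ioo (0:ℝ) 1) :
    ¬ ∃ d : ℝ, HasDerivAt (Mfun k a) d x := by
  rintro ⟨d, hd⟩
  have ha01 : a ∈ Ioo (0 : ℝ) 1 := by
    rcases ha with ha | rfl
    · exact ⟨by linarith [ha.1], ha.2⟩
    · norm_num
  have ht := tendsto_okIncr_of_hasDerivAt ha01 hx hd
  set s : ℕ → ℝ := fun n => 3 ^ n * (okIncr n ⌊3 ^ n * x⌋₊).eval a with hs
  have hs0 : s 0 = 1 := by simp [hs, okIncr_zero]
  have hstep (n : ℕ) : s (n + 1) = 3 * a * s n ∨ s (n + 1) = 3 * (1 - 2 * a) * s n := by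
    simp only [hs, okIncr_floor_succ, okRatio]
    split_ifs
    · right
      simp
      ring
    · left
      simp
      ring
  rcases ha with ⟨ha, -⟩ | rfl
  · have hone (n : ℕ) : 1 ≤ |s n| := by
      induction n with
      | zero => simp [hs0]
      | succ n ih =>
        rcases hstep n with h | h <;> rw [h, abs_mul]
        · exact one_le_mul_of_one_le_of_one_le (le_abs.2 (Or.inl (by linarith))) ih
        · exact one_le_mul_of_one_le_of_one_le (le_abs.2 (Or.inr (by linarith))) ih
    have hdiff (n : ℕ) : 1 ≤ |s (n + 1) - s n| := by
      rcases hstep n with h | h <;> rw [h, ← sub_one_mul, abs_mul]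
      · exact one_le_mul_of_one_le_of_one_le (le_abs.2 (Or.inl (by linarith))) (hone n)
      · exact one_le_mul_of_one_le_of_one_le (le_abs.2 (Or.inr (by linarith))) (hone n)
    have h0 := (((tendsto_add_atTop_iff_nat 1).2 ht).sub ht).abs
    rw [sub_self, abs_zero] at h0
    exact absurd (ge_of_tendsto' h0 hdiff) (by norm_num)
  · have hone (n : ℕ) : s n = 1 := by
      induction n with
      | zero => exact hs0
      | succ n ih => rcases hstep n with h | h <;> rw [h, ih] <;> norm_num
    have h0 : (1 - 3 * (1 / 3) : ℝ) ^ k = 0 := by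
      rw [show (1 - 3 * (1 / 3) : ℝ) = 0 by norm_num, zero_pow (by omega)]
    rw [h0, mul_zero, funext hone] at ht
    exact one_ne_zero (tendsto_nhds_unique tendsto_const_nhds ht)
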